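/- There is no 1-Lipschitz retraction from ℝ²(3) onto ℝ²(2): there is no map r : ℝ²(3) → ℝ²(2) satisfying d_H(r(A), r(B)) ≤ d_H(A, B) for all A, B ∈ ℝ²(3) and r(A) = A for every A ∈ ℝ²(2). -/

import Mathlib

/-- The key two-point bound: if `{m, y}` is within `s` of a three-point set `A`, then `r A` has
a point closer than `s + 1/10` to `y`. -/
theorem near_point_aux (r : Set (EuclideanSpace ℝ (Fin 2)) → Set (EuclideanSpace ℝ (Fin 2)))
    (h1 : ∀ A : Set (EuclideanSpace ℝ (Fin 2)), A.Nonempty → A.Finite → A.ncard ≤ 3 →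
        (r A).Nonempty ∧ (r A).Finite ∧ (r A).ncard ≤ 2)
    (h2 : ∀ A : Set (EuclideanSpace ℝ (Fin 2)), A.Nonempty → A.Finite → A.ncard ≤ 2 → r A = A)
    (h3 : ∀ A B : Set (EuclideanSpace ℝ (Fin 2)), A.Nonempty → A.Finite → A.ncard ≤ 3 →
        B.Nonempty → B.Finite → B.ncard ≤ 3 →
        Metric.hausdorffDist (r A) (r B) ≤ Metric.hausdorffDist A B)
    (A : Set (EuclideanSpace ℝ (Fin 2))) (hA : A.Nonempty) (hf : A.Finite) (hc : A.ncard ≤ 3)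
    (a b c m y : EuclideanSpace ℝ (Fin 2)) (hAe : A = {a, b, c}) (s : ℝ)
    (ha : dist a y ≤ s) (hb : dist b m ≤ s) (hcm : dist c m ≤ s) :
    ∃ p ∈ r A, dist p y < s + 1 / 10 := by
  have hn : ({m, y} : Set (EuclideanSpace ℝ (Fin 2))).Nonempty := ⟨m, by simp⟩
  have hfin : ({m, y} : Set (EuclideanSpace ℝ (Fin 2))).Finite := by simp
  have hcard : ({m, y} : Set (EuclideanSpace ℝ (Fin 2))).ncard ≤ 2 := by
    simpa using Set.ncard_insert_le m ({y} : Set (EuclideanSpace ℝ (Fin 2)))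
  have hs : 0 ≤ s := dist_nonneg.trans ha
  have hd : Metric.hausdorffDist A {m, y} ≤ s := by
    subst hAe
    apply Metric.hausdorffDist_le_of_mem_dist hs
    · rintro x (rfl | rfl | rfl)
      · exact ⟨y, by simp, ha⟩
      · exact ⟨m, by simp, hb⟩
      · exact ⟨m, by simp, hcm⟩
    · rintro x (rfl | rfl)
      · exact ⟨b, by simp, by rwa [dist_comm]⟩
      · exact ⟨a, by simp, by rwa [dist_comm]⟩
  have h := h3 A {m, y} hA hf hc hn hfin (by omega)
  rw [h2 _ hn hfin hcard] at h
  obtain ⟨hr, hrf, -⟩ := h1 A hA hf hc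
  exact Metric.exists_dist_lt_of_hausdorffDist_lt' (r := s + 1 / 10)
    (show y ∈ ({m, y} : Set (EuclideanSpace ℝ (Fin 2))) by simp) (by linarith)
    (Metric.hausdorffEDist_ne_top_of_nonempty_of_bounded hr hn hrf.isBounded hfin.isBounded)

/-- **Example.** There is no `1`-Lipschitz retraction from `ℝ²(3)` onto `ℝ²(2)`:
no map `r` taking nonempty subsets of `ℝ²` with at most `3` elements to nonempty subsets with
at most `2` elements can satisfy `d_H(r A, r B) ≤ d_H(A, B)` for all such `A, B` while fixing
every set with at most `2` elements. -/
theorem no_one_lipschitz_retraction_plane_three_to_two :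
    ¬ ∃ r : Set (EuclideanSpace ℝ (Fin 2)) → Set (EuclideanSpace ℝ (Fin 2)),
      (∀ A : Set (EuclideanSpace ℝ (Fin 2)), A.Nonempty → A.Finite → A.ncard ≤ 3 →
        (r A).Nonempty ∧ (r A).Finite ∧ (r A).ncard ≤ 2) ∧
      (∀ A : Set (EuclideanSpace ℝ (Fin 2)), A.Nonempty → A.Finite → A.ncard ≤ 2 → r A = A) ∧
      (∀ A B : Set (EuclideanSpace ℝ (Fin 2)), A.Nonempty → A.Finite → A.ncard ≤ 3 →
        B.Nonempty → B.Finite → B.ncard ≤ 3 →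
        Metric.hausdorffDist (r A) (r B) ≤ Metric.hausdorffDist A B) := by
  rintro ⟨r, h1, h2, h3⟩
  let a : EuclideanSpace ℝ (Fin 2) := !₂[-2, 0]
  let b : EuclideanSpace ℝ (Fin 2) := !₂[2, 0]
  let c : EuclideanSpace ℝ (Fin 2) := !₂[0, 0]
  let A : Set (EuclideanSpace ℝ (Fin 2)) := {a, b, c}
  have hA : A.Nonempty := ⟨a, by simp [A]⟩
  have hf : A.Finite := by simp [A]
  have hc : A.ncard ≤ 3 := by
    have e1 := Set.ncard_insert_le a ({b, c} : Set (EuclideanSpace ℝ (Fin 2)))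
    have e2 := Set.ncard_insert_le b ({c} : Set (EuclideanSpace ℝ (Fin 2)))
    rw [Set.ncard_singleton] at e2
    exact e1.trans (by omega)
  have key := near_point_aux r h1 h2 h3 A hA hf hc
  obtain ⟨p, hp, hpd⟩ := key a b c !₂[1, 0] !₂[-3, 0] rfl 1
    (by rw [EuclideanSpace.dist_eq, Real.sqrt_le_left (by norm_num)]; simp [a, Real.dist_eq]; norm_num)
    (by rw [EuclideanSpace.dist_eq, Real.sqrt_le_left (by norm_num)]; simp [b, Real.dist_eq]; norm_num)
    (by rw [EuclideanSpace.dist_eq, Real.sqrt_le_left (by norm_num)]; simp [c, Real.dist_eq])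
  obtain ⟨q, hq, hqd⟩ := key b a c !₂[-1, 0] !₂[3, 0] (Set.insert_comm _ _ _) 1
    (by rw [EuclideanSpace.dist_eq, Real.sqrt_le_left (by norm_num)]; simp [b, Real.dist_eq]; norm_num)
    (by rw [EuclideanSpace.dist_eq, Real.sqrt_le_left (by norm_num)]; simp [a, Real.dist_eq]; norm_num)
    (by rw [EuclideanSpace.dist_eq, Real.sqrt_le_left (by norm_num)]; simp [c, Real.dist_eq])
  obtain ⟨t, ht, htd⟩ := key c a b !₂[0, 0] !₂[0, 2]
    (by ext x; simp only [A, Set.mem_insert_iff, Set.mem_singleton_iff]; tauto) 2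
    (by rw [EuclideanSpace.dist_eq, Real.sqrt_le_left (by norm_num)]; simp [c, Real.dist_eq])
    (by rw [EuclideanSpace.dist_eq, Real.sqrt_le_left (by norm_num)]; simp [a, Real.dist_eq])
    (by rw [EuclideanSpace.dist_eq, Real.sqrt_le_left (by norm_num)]; simp [b, Real.dist_eq])
  have hyab : (5 : ℝ) ≤ dist (!₂[-3, 0] : EuclideanSpace ℝ (Fin 2)) !₂[3, 0] := by
    rw [EuclideanSpace.dist_eq]; apply Real.le_sqrt_of_sq_le; simp [Real.dist_eq]; norm_num
  have hyac : (33 / 10 : ℝ) ≤ dist (!₂[-3, 0] : EuclideanSpace ℝ (Fin 2)) !₂[0, 2] := by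
    rw [EuclideanSpace.dist_eq]; apply Real.le_sqrt_of_sq_le; simp [Real.dist_eq]; norm_num
  have hybc : (33 / 10 : ℝ) ≤ dist (!₂[3, 0] : EuclideanSpace ℝ (Fin 2)) !₂[0, 2] := by
    rw [EuclideanSpace.dist_eq]; apply Real.le_sqrt_of_sq_le; simp [Real.dist_eq]; norm_num
  have hpq : p ≠ q := by
    rintro rfl
    linarith [dist_triangle_left (!₂[-3, 0] : EuclideanSpace ℝ (Fin 2)) !₂[3, 0] p]
  have hpt : p ≠ t := by
    rintro rfl
    linarith [dist_triangle_left (!₂[-3, 0] : EuclideanSpace ℝ (Fin 2)) !₂[0, 2] p]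
  have hqt : q ≠ t := by
    rintro rfl
    linarith [dist_triangle_left (!₂[3, 0] : EuclideanSpace ℝ (Fin 2)) !₂[0, 2] q]
  obtain ⟨-, hrf, hrc⟩ := h1 A hA hf hc
  have hlt : 2 < (r A).ncard := (Set.two_lt_ncard_iff hrf).2 ⟨p, q, t, hp, hq, ht, hpq, hpt, hqt⟩
  omega
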